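/- For every natural number n and every real number y, the function I(n, y) = integral over x from -1 to 1 of (1-x^2)^{-1/2} * T_n(1 - x^2*y) dx satisfies the recurrence (2n^2 + 2n) * I(n+1, y) + (2n*y^2 - 4n*y + y^2 - 2y) * I_y(n, y) + (2n^2*y - 2n^2 + n*y - 2n) * I(n, y) = 0. -/

import Mathlib

open MeasureTheory Real intervalIntegral

/-- `I(n,y) = ∫_{-1}^1 (1-x²)^{-1/2} T_n(1-x²y) dx`. -/
noncomputable def chebInt (n : ℕ) (y : ℝ) : ℝ :=
  ∫ x in (-1 : ℝ)..1,
    (1 - x ^ 2) ^ (-(1 : ℝ) / 2) * (Polynomial.Chebyshev.T ℝ n).eval (1 - x ^ 2 * y)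

theorem chebInt_eq_cos (n : ℕ) (y : ℝ) : chebInt n y =
    ∫ t in (0:ℝ)..π, (Polynomial.Chebyshev.T ℝ n).eval (1 - cos t ^ 2 * y) := by
  rw [← Polynomial.Chebyshev.integral_measureT_eq_integral_cos
    (f := fun x => (Polynomial.Chebyshev.T ℝ n).eval (1 - x ^ 2 * y)),
    Polynomial.Chebyshev.integral_measureT, chebInt]
  refine intervalIntegral.integral_congr fun x hx => ?_
  rw [Set.uIcc_of_le (by norm_num)] at hx
  have h : 0 ≤ 1 - x ^ 2 := by nlinarith [hx.1, hx.2]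
  rw [mul_comm]
  congr 1
  rw [Real.sqrt_eq_rpow, ← Real.rpow_neg_one, ← Real.rpow_mul h]
  norm_num

theorem poly_eval_hasDerivAt (p : Polynomial ℝ) (c y : ℝ) :
    HasDerivAt (fun y => p.eval (1 - c * y)) (-(c * p.derivative.eval (1 - c * y))) y := by
  have h1 : HasDerivAt (fun y : ℝ => 1 - c * y) (-c) y := by
    simpa using ((hasDerivAt_id y).const_mul c).const_sub 1
  have := (p.hasDerivAt (1 - c * y)).comp y h1
  convert! this using 1
  ring

theorem chebInt_hasDerivAt (n : ℕ) (y : ℝ) : HasDerivAt (chebInt n)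
    (∫ t in (0:ℝ)..π, -(cos t ^ 2 *
      (Polynomial.Chebyshev.T ℝ n).derivative.eval (1 - cos t ^ 2 * y))) y := by
  have e : chebInt n = fun y =>
      ∫ t in (0:ℝ)..π, (Polynomial.Chebyshev.T ℝ n).eval (1 - cos t ^ 2 * y) :=
    funext fun y => chebInt_eq_cos n y
  rw [e]
  have hc : Continuous fun q : ℝ × ℝ => -(cos q.2 ^ 2 *
      (Polynomial.Chebyshev.T ℝ n).derivative.eval (1 - cos q.2 ^ 2 * q.1)) := by fun_prop
  obtain ⟨C, hC⟩ := ((isCompact_Icc (a := y - 1) (b := y + 1)).prod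
    (isCompact_Icc (a := (0:ℝ)) (b := π))).exists_bound_of_continuousOn hc.continuousOn
  refine (intervalIntegral.hasDerivAt_integral_of_dominated_loc_of_deriv_le
    (F := fun y t => (Polynomial.Chebyshev.T ℝ n).eval (1 - cos t ^ 2 * y))
    (F' := fun y t => -(cos t ^ 2 *
      (Polynomial.Chebyshev.T ℝ n).derivative.eval (1 - cos t ^ 2 * y)))
    (bound := fun _ => C)
    (Icc_mem_nhds (show y - 1 < y by linarith) (show y < y + 1 by linarith))
    (Filter.Eventually.of_forall fun x => ?_) ?_ ?_ (Filter.Eventually.of_forall ?_) ?_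
    (Filter.Eventually.of_forall ?_)).2
  · exact Continuous.aestronglyMeasurable (by fun_prop)
  · exact Continuous.intervalIntegrable (by fun_prop) _ _
  · exact Continuous.aestronglyMeasurable (by fun_prop)
  · intro t ht x hx
    rw [Set.uIoc_of_le pi_pos.le] at ht
    exact hC (x, t) ⟨hx, ht.1.le, ht.2⟩
  · simp
  · intro t _ x _
    exact poly_eval_hasDerivAt _ _ _

theorem cheb_first (n : ℕ) (u : ℝ) :
    (n : ℝ) * (Polynomial.Chebyshev.T ℝ (n + 1 : ℕ)).eval u =
      n * u * (Polynomial.Chebyshev.T ℝ n).eval u -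
      (1 - u ^ 2) * (Polynomial.Chebyshev.T ℝ n).derivative.eval u := by
  have h := congrArg (Polynomial.eval u)
    (Polynomial.Chebyshev.one_sub_X_sq_mul_derivative_T_eq_poly_in_T (R := ℝ) ((n : ℤ) - 1))
  have h2 := congrArg (Polynomial.eval u) (Polynomial.Chebyshev.T_add_two ℝ ((n : ℤ) - 1))
  rw [show (n : ℤ) - 1 + 2 = ((n + 1 : ℕ) : ℤ) by push_cast; ring] at h2
  simp only [sub_add_cancel] at h h2
  simp at h h2
  push_cast
  linear_combination h + n * h2

theorem cheb_ode (n : ℕ) (u : ℝ) :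
    (1 - u ^ 2) * (Polynomial.Chebyshev.T ℝ n).derivative.derivative.eval u =
      u * (Polynomial.Chebyshev.T ℝ n).derivative.eval u -
      (n : ℝ) ^ 2 * (Polynomial.Chebyshev.T ℝ n).eval u := by
  have h := congrArg (Polynomial.eval u)
    (Polynomial.Chebyshev.one_sub_X_sq_mul_derivative_derivative_T_eq_poly_in_T (R := ℝ) (n : ℤ))
  simpa using h

theorem poly_cos_hasDerivAt (p : Polynomial ℝ) (y t : ℝ) :
    HasDerivAt (fun t => p.eval (1 - cos t ^ 2 * y))
      (2 * y * cos t * sin t * p.derivative.eval (1 - cos t ^ 2 * y)) t := by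
  have h1 : HasDerivAt (fun t : ℝ => 1 - cos t ^ 2 * y) (2 * y * cos t * sin t) t := by
    have := (((hasDerivAt_cos t).pow 2).mul_const y).const_sub 1
    convert! this using 1
    push_cast
    ring
  have := (p.hasDerivAt (1 - cos t ^ 2 * y)).comp t h1
  convert! this using 1
  ring

/-- The recurrence
`(2n²+2n) I(n+1,y) + (2ny²-4ny+y²-2y) I_y(n,y) + (2n²y-2n²+ny-2n) I(n,y) = 0`. -/
theorem chebInt_recurrence (n : ℕ) (y : ℝ) :
    (2 * (n : ℝ) ^ 2 + 2 * n) * chebInt (n + 1) y +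
      (2 * n * y ^ 2 - 4 * n * y + y ^ 2 - 2 * y) * deriv (chebInt n) y +
      (2 * (n : ℝ) ^ 2 * y - 2 * (n : ℝ) ^ 2 + n * y - 2 * n) * chebInt n y = 0 := by
  rw [(chebInt_hasDerivAt n y).deriv, chebInt_eq_cos, chebInt_eq_cos,
    ← intervalIntegral.integral_const_mul, ← intervalIntegral.integral_const_mul,
    ← intervalIntegral.integral_const_mul, ← intervalIntegral.integral_add,
    ← intervalIntegral.integral_add]
  rotate_left
  · exact Continuous.intervalIntegrable (by fun_prop) _ _
  · exact Continuous.intervalIntegrable (by fun_prop) _ _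
  · exact Continuous.intervalIntegrable (by fun_prop) _ _
  · exact Continuous.intervalIntegrable (by fun_prop) _ _
  rw [intervalIntegral.integral_eq_sub_of_hasDerivAt
    (f := fun t => y * (sin t * cos t) *
      (-(n : ℝ) * (Polynomial.Chebyshev.T ℝ n).eval (1 - cos t ^ 2 * y) -
        (2 - cos t ^ 2 * y) *
          (Polynomial.Chebyshev.T ℝ n).derivative.eval (1 - cos t ^ 2 * y)))]
  · simp
  · intro t _
    have hT := poly_cos_hasDerivAt (Polynomial.Chebyshev.T ℝ n) y t
    have hT' := poly_cos_hasDerivAt (Polynomial.Chebyshev.T ℝ n).derivative y t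
    have h1 : HasDerivAt (fun t : ℝ => 2 - cos t ^ 2 * y) (2 * y * cos t * sin t) t := by
      have := (((hasDerivAt_cos t).pow 2).mul_const y).const_sub 2
      convert! this using 1
      push_cast
      ring
    have h := (((hasDerivAt_sin t).mul (hasDerivAt_cos t)).const_mul y).mul
      ((hT.const_mul (-(n : ℝ))).sub (h1.mul hT'))
    convert! h using 1
    have a := cheb_first n (1 - cos t ^ 2 * y)
    have b := cheb_ode n (1 - cos t ^ 2 * y)
    have s : sin t ^ 2 = 1 - cos t ^ 2 := by rw [sin_sq]
    simp only [Pi.mul_apply, Pi.sub_apply]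
    generalize Polynomial.eval (1 - cos t ^ 2 * y) (Polynomial.Chebyshev.T ℝ n) = T0 at *
    generalize Polynomial.eval (1 - cos t ^ 2 * y)
      (Polynomial.Chebyshev.T ℝ n).derivative = T1 at *
    generalize Polynomial.eval (1 - cos t ^ 2 * y)
      (Polynomial.Chebyshev.T ℝ n).derivative.derivative = T2 at *
    generalize Polynomial.eval (1 - cos t ^ 2 * y)
      (Polynomial.Chebyshev.T ℝ (n + 1 : ℕ)) = T3 at *
    generalize cos t = c at *
    generalize sin t = z at *
    have key : y * (z * c) * (2 * y * c * z) * (2 - c ^ 2 * y) * T2 =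
        2 * y * (1 - c ^ 2) * ((1 - c ^ 2 * y) * T1 - n ^ 2 * T0) := by
      linear_combination 2 * y * z ^ 2 * b + 2 * y * ((1 - c ^ 2 * y) * T1 - n ^ 2 * T0) * s
    linear_combination (2 * (n : ℝ) + 2) * a + key + 
      (y * (n * T0 * (-1) - (2 - c ^ 2 * y) * T1) + 2 * y ^ 2 * c ^ 2 * (n * T1 + T1)) * s
  · exact Continuous.intervalIntegrable (by fun_prop) _ _
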